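/- Let F be a finite set of m ≥ 1 features with model π, instance v and similarity relations as above, and let ν_a(S) = 1 if S is a WAXp and 0 otherwise. If feature i ∈ F is irrelevant (belongs to no AXp), then its Shapley value with respect to ν_a is zero: Sc(i) = Σ_{S ⊆ F\{i}} (|S|!·(m−|S|−1)!/m!) · (ν_a(S ∪ {i}) − ν_a(S)) = 0. -/

import Mathlib

open Finset

/-- A set `S` of features is a weak abductive explanation (WAXp): for every point `x`
of feature space, if `x` is similar to `v` on all features in `S`, then the model
output at `x` is similar to the output at `v`. -/
def WAXp {m : ℕ} {D : Fin m → Type*} {T : Type*}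
    (π : (∀ i, D i) → T) (v : ∀ i, D i)
    (simD : ∀ i, D i → D i → Prop) (simT : T → T → Prop)
    (S : Finset (Fin m)) : Prop :=
  ∀ x : ∀ i, D i, (∀ i ∈ S, simD i (x i) (v i)) → simT (π x) (π v)

/-- An AXp is a subset-minimal WAXp. -/
def AXp {m : ℕ} {D : Fin m → Type*} {T : Type*}
    (π : (∀ i, D i) → T) (v : ∀ i, D i)
    (simD : ∀ i, D i → D i → Prop) (simT : T → T → Prop)
    (S : Finset (Fin m)) : Prop :=
  WAXp π v simD simT S ∧ ∀ S' ⊂ S, ¬ WAXp π v simD simT S'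

/-- The characteristic function `ν_a`: takes value 1 on WAXps and 0 otherwise. -/
noncomputable def nuA {m : ℕ} {D : Fin m → Type*} {T : Type*}
    (π : (∀ i, D i) → T) (v : ∀ i, D i)
    (simD : ∀ i, D i → D i → Prop) (simT : T → T → Prop)
    (S : Finset (Fin m)) : ℝ := by
  classical exact if WAXp π v simD simT S then 1 else 0

/-- The Shapley value (SHAP score) of feature `i` w.r.t. the characteristic
function `ν_a`. -/
noncomputable def Sc {m : ℕ} {D : Fin m → Type*} {T : Type*}
    (π : (∀ i, D i) → T) (v : ∀ i, D i)
    (simD : ∀ i, D i → D i → Prop) (simT : T → T → Prop)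
    (i : Fin m) : ℝ :=
  ∑ S ∈ (Finset.univ.erase i).powerset,
    ((Nat.factorial S.card : ℝ) * (Nat.factorial (m - S.card - 1) : ℝ) /
        (Nat.factorial m : ℝ)) *
      (nuA π v simD simT (insert i S) - nuA π v simD simT S)

theorem WAXp.mono {m : ℕ} {D : Fin m → Type*} {T : Type*}
    {π : (∀ i, D i) → T} {v : ∀ i, D i}
    {simD : ∀ i, D i → D i → Prop} {simT : T → T → Prop}
    {S S' : Finset (Fin m)} (h : S ⊆ S') (hS : WAXp π v simD simT S) :
    WAXp π v simD simT S' :=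
  fun x hx => hS x fun j hj => hx j (h hj)

theorem WAXp.exists_axp_subset {m : ℕ} {D : Fin m → Type*} {T : Type*}
    {π : (∀ i, D i) → T} {v : ∀ i, D i}
    {simD : ∀ i, D i → D i → Prop} {simT : T → T → Prop}
    {S : Finset (Fin m)} (hS : WAXp π v simD simT S) :
    ∃ A ⊆ S, AXp π v simD simT A := by
  obtain ⟨A, hAS, hA⟩ := exists_minimal_le_of_wellFoundedLT (WAXp π v simD simT) S hS
  exact ⟨A, hAS, hA.prop, fun S' hS' => hA.not_prop_of_lt hS'⟩

theorem waxp_insert_iff_of_irrelevant {m : ℕ} {D : Fin m → Type*} {T : Type*}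
    {π : (∀ i, D i) → T} {v : ∀ i, D i}
    {simD : ∀ i, D i → D i → Prop} {simT : T → T → Prop} {i : Fin m}
    (hirr : ¬ ∃ A : Finset (Fin m), AXp π v simD simT A ∧ i ∈ A) (S : Finset (Fin m)) :
    WAXp π v simD simT (insert i S) ↔ WAXp π v simD simT S := by
  refine ⟨fun h => ?_, WAXp.mono (Finset.subset_insert i S)⟩
  obtain ⟨A, hAS, hA⟩ := h.exists_axp_subset
  have hiA : i ∉ A := fun hi => hirr ⟨A, hA, hi⟩
  exact hA.1.mono ((Finset.subset_insert_iff_of_notMem hiA).1 hAS)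

/-- an irrelevant feature has Shapley value 0 w.r.t. `ν_a`. -/
theorem irrelevant_shap_zero {m : ℕ} {D : Fin m → Type*} {T : Type*}
    (π : (∀ i, D i) → T) (v : ∀ i, D i)
    (simD : ∀ i, D i → D i → Prop) (simT : T → T → Prop)
    (hm : 1 ≤ m) (i : Fin m)
    (hirr : ¬ ∃ A : Finset (Fin m), AXp π v simD simT A ∧ i ∈ A) :
    Sc π v simD simT i = 0 := by
  refine Finset.sum_eq_zero fun S _ => ?_
  have h : nuA π v simD simT (insert i S) = nuA π v simD simT S := by
    unfold nuA
    classical exact if_congr (waxp_insert_iff_of_irrelevant hirr S) rfl rfl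
  rw [h, sub_self, mul_zero]
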